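/- arXiv:2008.10635 — 8 statements merged into one kernel-verified Lean document; each statement's English description precedes it below -/
import Mathlib

section
/- Let (u⁻,v⁻,p⁻) and (u⁺,v⁺,p⁺) be two constant states in ℝ³ with (u⁻,v⁻,p⁻) ≠ (u⁺,v⁺,p⁺), set E^± = ((u^±)² + (v^±)²)/2 + p^±, let ξ, η, σ ∈ ℝ, write [w] = w⁺ − w⁻ for the jump of a quantity w (so [pu] = p⁺u⁺ − p⁻u⁻, etc.) and p̄ = (p⁺ + p⁻)/2, and assume p̄ > 0. Suppose the Rankine–Hugoniot relations hold: (ξσ − η)[u] − σ[p] = 0, (ξσ − η)[v] + [p] = 0, (ξσ − η)[E] − σ[pu] + [pv] = 0. Then exactly one of the following two cases occurs: (linear discontinuity) ξσ − η = 0, in which case [p] = 0 and [v] = σ[u]; or (nonlinear discontinuity) ξσ − η ≠ 0, in which case [v] ≠ 0, [u] = −σ[v], [p]² = p̄([u]² + [v]²), and σ satisfies the quadratic equation (ξ² − p̄)σ² − 2ξησ + (η² − p̄) = 0; in particular, if in addition ξ² ≠ p̄ and p̄(ξ² + η² − p̄) ≥ 0, then σ = (ξη + √(p̄(ξ² + η²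 − p̄)))/(ξ² − p̄) or σ = (ξη − √(p̄(ξ² + η² − p̄)))/(ξ² − p̄). -/
open Real

/-- Classification of discontinuities of the pressure gradient system in
self-similar coordinates: along a discontinuity with slope `σ`, either a linear
discontinuity (vortex sheet) or a nonlinear discontinuity (shock) occurs. -/
theorem stmt0
    (um vm pm up vp pp ξ η σ : ℝ)
    (hne : (um, vm, pm) ≠ (up, vp, pp))
    (Em Ep pbar : ℝ)
    (hEm : Em = (um ^ 2 + vm ^ 2) / 2 + pm)
    (hEp : Ep = (up ^ 2 + vp ^ 2) / 2 + pp)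
    (hpbar : pbar = (pp + pm) / 2)
    (hpbarpos : 0 < pbar)
    (hRH1 : (ξ * σ - η) * (up - um) - σ * (pp - pm) = 0)
    (hRH2 : (ξ * σ - η) * (vp - vm) + (pp - pm) = 0)
    (hRH3 : (ξ * σ - η) * (Ep - Em) - σ * (pp * up - pm * um) + (pp * vp - pm * vm) = 0) :
    Xor'
      (ξ * σ - η = 0 ∧ pp - pm = 0 ∧ vp - vm = σ * (up - um))
      (ξ * σ - η ≠ 0 ∧ vp - vm ≠ 0 ∧ up - um = -(σ * (vp - vm)) ∧
        (pp - pm) ^ 2 = pbar * ((up - um) ^ 2 + (vp - vm) ^ 2) ∧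
        (ξ ^ 2 - pbar) * σ ^ 2 - 2 * ξ * η * σ + (η ^ 2 - pbar) = 0 ∧
        (ξ ^ 2 ≠ pbar → 0 ≤ pbar * (ξ ^ 2 + η ^ 2 - pbar) →
          σ = (ξ * η + Real.sqrt (pbar * (ξ ^ 2 + η ^ 2 - pbar))) / (ξ ^ 2 - pbar) ∨
          σ = (ξ * η - Real.sqrt (pbar * (ξ ^ 2 + η ^ 2 - pbar))) / (ξ ^ 2 - pbar))) := by
  have key : (ξ * σ - η) * (pp - pm) - σ * pbar * (up - um) + pbar * (vp - vm) = 0 := by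
    subst hEm hEp hpbar
    linear_combination hRH3 - (up + um) / 2 * hRH1 - (vp + vm) / 2 * hRH2
  by_cases hD : ξ * σ - η = 0
  · left
    have hp : pp - pm = 0 := by
      rw [hD] at hRH2
      linarith
    refine ⟨⟨hD, hp, ?_⟩, fun h => h.1 hD⟩
    apply mul_left_cancel₀ hpbarpos.ne'
    linear_combination key - (pp - pm) * hD
  · right
    have hu : up - um = -(σ * (vp - vm)) := by
      apply mul_left_cancel₀ hD
      linear_combination hRH1 + σ * hRH2
    have hp : pp - pm = -((ξ * σ - η) * (vp - vm)) := by linarith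
    have hv : vp - vm ≠ 0 := by
      intro hv
      apply hne
      rw [hv] at hu hp
      have h1 : um = up := by linarith
      have h2 : vm = vp := by linarith
      have h3 : pm = pp := by linarith
      rw [h1, h2, h3]
    have hD2 : (ξ * σ - η) ^ 2 = pbar * (1 + σ ^ 2) := by
      apply mul_right_cancel₀ hv
      rw [hu, hp] at key
      linear_combination -key
    have hq : (ξ ^ 2 - pbar) * σ ^ 2 - 2 * ξ * η * σ + (η ^ 2 - pbar) = 0 := by
      linear_combination hD2
    refine ⟨⟨hD, hv, hu, ?_, hq, ?_⟩, fun h => hD h.1⟩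
    · rw [hu, hp]
      linear_combination (vp - vm) ^ 2 * hD2
    · intro hx h0
      have hx' : ξ ^ 2 - pbar ≠ 0 := sub_ne_zero.mpr hx
      have hs := Real.sq_sqrt h0
      have hsq : ((ξ ^ 2 - pbar) * σ - ξ * η) ^ 2
          = Real.sqrt (pbar * (ξ ^ 2 + η ^ 2 - pbar)) ^ 2 := by
        rw [hs]
        linear_combination (ξ ^ 2 - pbar) * hq
      rcases sq_eq_sq_iff_eq_or_eq_neg.mp hsq with h | h
      · left
        rw [eq_div_iff hx']
        linarith
      · right
        rw [eq_div_iff hx']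
        linarith
end

section
/- Let U ⊆ ℝ² be open and let u, v, p : U → ℝ be twice continuously differentiable with p > 0 on U. Suppose that, writing E = (u² + v²)/2 + p, the self-similar pressure gradient system holds on U: (ξu)_ξ + (ηu)_η − p_ξ − 2u = 0, (ξv)_ξ + (ηv)_η − p_η − 2v = 0, and (ξE)_ξ + (ηE)_η − (pu)_ξ − (pv)_η − 2E = 0. Then p satisfies the second-order equation (p − ξ²) p_{ξξ} − 2ξη p_{ξη} + (p − η²) p_{ηη} + (ξ p_ξ + η p_η)²/p − 2(ξ p_ξ + η p_η) = 0 on U. -/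
open Real Set

/-- Partial derivative in the first (ξ) variable. -/
noncomputable def pdx (f : ℝ × ℝ → ℝ) (z : ℝ × ℝ) : ℝ := fderiv ℝ f z (1, 0)

/-- Partial derivative in the second (η) variable. -/
noncomputable def pdy (f : ℝ × ℝ → ℝ) (z : ℝ × ℝ) : ℝ := fderiv ℝ f z (0, 1)


lemma pdx_mul {f g : ℝ × ℝ → ℝ} {z : ℝ × ℝ} (hf : DifferentiableAt ℝ f z)
    (hg : DifferentiableAt ℝ g z) :
    pdx (fun w => f w * g w) z = pdx f z * g z + f z * pdx g z := by
  unfold pdx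
  rw [fderiv_fun_mul hf hg]
  simp
  ring

lemma pdx_add {f g : ℝ × ℝ → ℝ} {z : ℝ × ℝ} (hf : DifferentiableAt ℝ f z)
    (hg : DifferentiableAt ℝ g z) :
    pdx (fun w => f w + g w) z = pdx f z + pdx g z := by
  unfold pdx
  rw [fderiv_fun_add hf hg]
  simp

lemma pdx_fst (z : ℝ × ℝ) : pdx (fun w => w.1) z = 1 := by
  unfold pdx
  rw [fderiv_fst]
  simp

lemma pdx_snd (z : ℝ × ℝ) : pdx (fun w => w.2) z = 0 := by
  unfold pdx
  rw [fderiv_snd]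
  simp

lemma pdx_diff {f : ℝ × ℝ → ℝ} {z : ℝ × ℝ} (hf : ContDiffAt ℝ 2 f z) :
    DifferentiableAt ℝ (pdx f) z := by
  have h : DifferentiableAt ℝ (fderiv ℝ f) z :=
    (hf.fderiv_right (m := 1) (by norm_num)).differentiableAt (by norm_num)
  unfold pdx
  exact h.clm_apply (differentiableAt_const _)

lemma pdx_congr {f g : ℝ × ℝ → ℝ} {U : Set (ℝ × ℝ)} (hU : IsOpen U) {z : ℝ × ℝ} (hz : z ∈ U)
    (h : ∀ w ∈ U, f w = g w) : pdx f z = pdx g z := by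
  unfold pdx
  have : f =ᶠ[nhds z] g := Filter.eventually_of_mem (hU.mem_nhds hz) h
  rw [this.fderiv_eq]

lemma pdy_mul {f g : ℝ × ℝ → ℝ} {z : ℝ × ℝ} (hf : DifferentiableAt ℝ f z)
    (hg : DifferentiableAt ℝ g z) :
    pdy (fun w => f w * g w) z = pdy f z * g z + f z * pdy g z := by
  unfold pdy
  rw [fderiv_fun_mul hf hg]
  simp
  ring

lemma pdy_add {f g : ℝ × ℝ → ℝ} {z : ℝ × ℝ} (hf : DifferentiableAt ℝ f z)
    (hg : DifferentiableAt ℝ g z) :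
    pdy (fun w => f w + g w) z = pdy f z + pdy g z := by
  unfold pdy
  rw [fderiv_fun_add hf hg]
  simp

lemma pdy_fst (z : ℝ × ℝ) : pdy (fun w => w.1) z = 0 := by
  unfold pdy
  rw [fderiv_fst]
  simp

lemma pdy_snd (z : ℝ × ℝ) : pdy (fun w => w.2) z = 1 := by
  unfold pdy
  rw [fderiv_snd]
  simp

lemma pdy_diff {f : ℝ × ℝ → ℝ} {z : ℝ × ℝ} (hf : ContDiffAt ℝ 2 f z) :
    DifferentiableAt ℝ (pdy f) z := by
  have h : DifferentiableAt ℝ (fderiv ℝ f) z :=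
    (hf.fderiv_right (m := 1) (by norm_num)).differentiableAt (by norm_num)
  unfold pdy
  exact h.clm_apply (differentiableAt_const _)

lemma pdy_congr {f g : ℝ × ℝ → ℝ} {U : Set (ℝ × ℝ)} (hU : IsOpen U) {z : ℝ × ℝ} (hz : z ∈ U)
    (h : ∀ w ∈ U, f w = g w) : pdy f z = pdy g z := by
  unfold pdy
  have : f =ᶠ[nhds z] g := Filter.eventually_of_mem (hU.mem_nhds hz) h
  rw [this.fderiv_eq]

lemma pd_comm {f : ℝ × ℝ → ℝ} {z : ℝ × ℝ} (hf : ContDiffAt ℝ 2 f z) :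
    pdx (pdy f) z = pdy (pdx f) z := by
  have h : DifferentiableAt ℝ (fderiv ℝ f) z :=
    (hf.fderiv_right (m := 1) (by norm_num)).differentiableAt (by norm_num)
  have hs : IsSymmSndFDerivAt ℝ f z := hf.isSymmSndFDerivAt (by simp)
  have e1 : pdx (pdy f) z = fderiv ℝ (fderiv ℝ f) z (1, 0) (0, 1) := by
    unfold pdx pdy
    rw [fderiv_clm_apply h (differentiableAt_const _)]
    simp
  have e2 : pdy (pdx f) z = fderiv ℝ (fderiv ℝ f) z (0, 1) (1, 0) := by
    unfold pdx pdy
    rw [fderiv_clm_apply h (differentiableAt_const _)]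
    simp
  rw [e1, e2]
  exact hs _ _

lemma pdx_euler {f : ℝ × ℝ → ℝ} {z : ℝ × ℝ} (hf : ContDiffAt ℝ 2 f z) :
    pdx (fun w => w.1 * pdx f w + w.2 * pdy f w) z
      = pdx f z + z.1 * pdx (pdx f) z + z.2 * pdx (pdy f) z := by
  have hx := pdx_diff hf
  have hy := pdy_diff hf
  rw [pdx_add (by fun_prop) (by fun_prop), pdx_mul (by fun_prop) hx, pdx_mul (by fun_prop) hy,
    pdx_fst, pdx_snd]
  ring

lemma pdy_euler {f : ℝ × ℝ → ℝ} {z : ℝ × ℝ} (hf : ContDiffAt ℝ 2 f z) :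
    pdy (fun w => w.1 * pdx f w + w.2 * pdy f w) z
      = pdy f z + z.1 * pdy (pdx f) z + z.2 * pdy (pdy f) z := by
  have hx := pdx_diff hf
  have hy := pdy_diff hf
  rw [pdy_add (by fun_prop) (by fun_prop), pdy_mul (by fun_prop) hx, pdy_mul (by fun_prop) hy,
    pdy_fst, pdy_snd]
  ring

/-- From a C² solution `(u,v,p)` of the self-similar pressure gradient system
one derives the second-order equation for the pressure `p`. -/
theorem stmt3
    (U : Set (ℝ × ℝ)) (hU : IsOpen U)
    (u v p : ℝ × ℝ → ℝ)
    (hu : ContDiffOn ℝ 2 u U) (hv : ContDiffOn ℝ 2 v U) (hp : ContDiffOn ℝ 2 p U)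
    (hppos : ∀ z ∈ U, 0 < p z)
    (E : ℝ × ℝ → ℝ) (hE : E = fun z => (u z ^ 2 + v z ^ 2) / 2 + p z)
    (heq1 : ∀ z ∈ U,
      pdx (fun w => w.1 * u w) z + pdy (fun w => w.2 * u w) z - pdx p z - 2 * u z = 0)
    (heq2 : ∀ z ∈ U,
      pdx (fun w => w.1 * v w) z + pdy (fun w => w.2 * v w) z - pdy p z - 2 * v z = 0)
    (heq3 : ∀ z ∈ U,
      pdx (fun w => w.1 * E w) z + pdy (fun w => w.2 * E w) z
        - pdx (fun w => p w * u w) z - pdy (fun w => p w * v w) z - 2 * E z = 0) :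
    ∀ z ∈ U,
      (p z - z.1 ^ 2) * pdx (pdx p) z - 2 * z.1 * z.2 * pdy (pdx p) z
        + (p z - z.2 ^ 2) * pdy (pdy p) z
        + (z.1 * pdx p z + z.2 * pdy p z) ^ 2 / p z
        - 2 * (z.1 * pdx p z + z.2 * pdy p z) = 0 := by
  have cu : ∀ z ∈ U, ContDiffAt ℝ 2 u z := fun z hz => hu.contDiffAt (hU.mem_nhds hz)
  have cv : ∀ z ∈ U, ContDiffAt ℝ 2 v z := fun z hz => hv.contDiffAt (hU.mem_nhds hz)
  have cp : ∀ z ∈ U, ContDiffAt ℝ 2 p z := fun z hz => hp.contDiffAt (hU.mem_nhds hz)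
  have du : ∀ z ∈ U, DifferentiableAt ℝ u z := fun z hz => (cu z hz).differentiableAt (by norm_num)
  have dv : ∀ z ∈ U, DifferentiableAt ℝ v z := fun z hz => (cv z hz).differentiableAt (by norm_num)
  have dp : ∀ z ∈ U, DifferentiableAt ℝ p z := fun z hz => (cp z hz).differentiableAt (by norm_num)
  have k1 : ∀ z ∈ U, z.1 * pdx u z + z.2 * pdy u z = pdx p z := by
    intro z hz
    have h := heq1 z hz
    rw [pdx_mul (by fun_prop) (du z hz), pdy_mul (by fun_prop) (du z hz), pdx_fst, pdy_snd] at h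
    linarith
  have k2 : ∀ z ∈ U, z.1 * pdx v z + z.2 * pdy v z = pdy p z := by
    intro z hz
    have h := heq2 z hz
    rw [pdx_mul (by fun_prop) (dv z hz), pdy_mul (by fun_prop) (dv z hz), pdx_fst, pdy_snd] at h
    linarith
  have k3 : ∀ z ∈ U, z.1 * pdx p z + z.2 * pdy p z = p z * (pdx u z + pdy v z) := by
    intro z hz
    have h := heq3 z hz
    have du' := du z hz
    have dv' := dv z hz
    have dp' := dp z hz
    have hE' : E = fun w => (1 / 2 : ℝ) * (u w * u w + v w * v w) + p w := by
      rw [hE]; funext w; ring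
    have dE : DifferentiableAt ℝ E z := by rw [hE']; fun_prop
    have c0 : pdx (fun _ => (1 / 2 : ℝ)) z = 0 := by simp [pdx]
    have c1 : pdy (fun _ => (1 / 2 : ℝ)) z = 0 := by simp [pdy]
    have ex : pdx E z = u z * pdx u z + v z * pdx v z + pdx p z := by
      rw [hE', pdx_add (by fun_prop) dp', pdx_mul (by fun_prop) (by fun_prop),
        pdx_add (by fun_prop) (by fun_prop), pdx_mul du' du', pdx_mul dv' dv', c0]
      ring
    have ey : pdy E z = u z * pdy u z + v z * pdy v z + pdy p z := by
      rw [hE', pdy_add (by fun_prop) dp', pdy_mul (by fun_prop) (by fun_prop),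
        pdy_add (by fun_prop) (by fun_prop), pdy_mul du' du', pdy_mul dv' dv', c1]
      ring
    rw [pdx_mul (by fun_prop) dE, pdy_mul (by fun_prop) dE, pdx_mul dp' du', pdy_mul dp' dv',
      pdx_fst, pdy_snd, ex, ey] at h
    linear_combination h - u z * k1 z hz - v z * k2 z hz
  intro z hz
  have a1 := pdx_congr hU hz k1
  have a2 := pdy_congr hU hz k2
  have a3 := pdx_congr hU hz k3
  have a4 := pdy_congr hU hz k3
  have ux := pdx_diff (cu z hz)
  have vy := pdy_diff (cv z hz)
  rw [pdx_euler (cu z hz)] at a1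
  rw [pdy_euler (cv z hz)] at a2
  rw [pdx_euler (cp z hz), pdx_mul (dp z hz) (by fun_prop), pdx_add ux vy, pd_comm (cp z hz),
    pd_comm (cv z hz)] at a3
  rw [pdy_euler (cp z hz), pdy_mul (dp z hz) (by fun_prop), pdy_add ux vy] at a4
  rw [pd_comm (cu z hz)] at a1
  have k := k3 z hz
  have pos := (hppos z hz).ne'
  have hq : (z.1 * pdx p z + z.2 * pdy p z) ^ 2 / p z
      = (z.1 * pdx p z + z.2 * pdy p z) * (pdx u z + pdy v z) := by
    rw [k]; field_simp
  rw [hq]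
  linear_combination -p z * a1 - p z * a2 - z.1 * a3 - z.2 * a4 - k
end

section
/- Let (u, v, p) and (u₂, v₂, p₂) be two constant states with E = (u²+v²)/2 + p and E₂ = (u₂²+v₂²)/2 + p₂, write [w] for the difference of a quantity w between the two states (so [pu] = pu − p₂u₂, etc.), and set p̄ = (p + p₂)/2. Let r > 0, θ ∈ ℝ, and r′ ∈ ℝ satisfy the Rankine–Hugoniot relations in polar form: r[u] − [p] cos θ = (r′/r) sin θ [p], r[v] − [p] sin θ = −(r′/r) cos θ [p], and r[E] − [pu] cos θ − [pv] sin θ = (r′/r)(sin θ [pu] − cos θ [pv]). If p̄ > 0 and [p] ≠ 0, then (r′)² = r²(r² − p̄)/p̄ and [p]² = p̄([u]² + [v]²). -/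
open Real

/-- Consequences of the Rankine–Hugoniot conditions in polar form across the
diffracted shock of the pressure gradient system: the shock ODE
`(r′)² = r²(r² − p̄)/p̄` and the jump relation `[p]² = p̄([u]² + [v]²)`. -/
theorem stmt6
    (u v p u₂ v₂ p₂ r θ r' : ℝ)
    (E E₂ pbar : ℝ)
    (hE : E = (u ^ 2 + v ^ 2) / 2 + p) (hE₂ : E₂ = (u₂ ^ 2 + v₂ ^ 2) / 2 + p₂)
    (hpbar : pbar = (p + p₂) / 2)
    (hr : 0 < r)
    (h1 : r * (u - u₂) - (p - p₂) * Real.cos θ = (r' / r) * Real.sin θ * (p - p₂))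
    (h2 : r * (v - v₂) - (p - p₂) * Real.sin θ = -((r' / r) * Real.cos θ * (p - p₂)))
    (h3 : r * (E - E₂) - (p * u - p₂ * u₂) * Real.cos θ - (p * v - p₂ * v₂) * Real.sin θ
      = (r' / r) * (Real.sin θ * (p * u - p₂ * u₂) - Real.cos θ * (p * v - p₂ * v₂)))
    (hpb : 0 < pbar) (hjp : p - p₂ ≠ 0) :
    r' ^ 2 = r ^ 2 * (r ^ 2 - pbar) / pbar ∧
    (p - p₂) ^ 2 = pbar * ((u - u₂) ^ 2 + (v - v₂) ^ 2) := by
  have hcs := Real.sin_sq_add_cos_sq θ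
  obtain ⟨k, hk⟩ : ∃ k, k = r' / r := ⟨_, rfl⟩
  have hr' : r' = k * r := by rw [hk]; field_simp
  rw [← hk] at h1 h2 h3
  generalize Real.sin θ = s at *
  generalize Real.cos θ = c at *
  have e1 : r * (u - u₂) = (p - p₂) * (c + k * s) := by linear_combination h1
  have e2 : r * (v - v₂) = (p - p₂) * (s - k * c) := by linear_combination h2
  have key : r * (p - p₂) = pbar * ((c + k * s) * (u - u₂) + (s - k * c) * (v - v₂)) := by
    subst hE hE₂ hpbar
    linear_combination h3 - (u + u₂) / 2 * e1 - (v + v₂) / 2 * e2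
  have hR : r ^ 2 = pbar * (1 + k ^ 2) := by
    apply mul_left_cancel₀ hjp
    linear_combination r * key + pbar * (c + k * s) * e1 + pbar * (s - k * c) * e2
      + (p - p₂) * pbar * (1 + k ^ 2) * hcs
  constructor
  · rw [eq_div_iff hpb.ne', hr']
    linear_combination -r ^ 2 * hR
  · apply mul_left_cancel₀ (pow_ne_zero 2 hr.ne')
    linear_combination (p - p₂) ^ 2 * hR
      - pbar * (r * (u - u₂) + (p - p₂) * (c + k * s)) * e1
      - pbar * (r * (v - v₂) + (p - p₂) * (s - k * c)) * e2
      - pbar * (p - p₂) ^ 2 * (1 + k ^ 2) * hcs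
end

section
/- Let 0 < ξ₁ and let η : (0, ξ₁) → ℝ be twice differentiable and p̄ : (0, ξ₁) → ℝ be differentiable, with p̄(ξ) > 0, p̄′(ξ) ≥ 0, ξ² ≠ p̄(ξ), and ξ² + η(ξ)² > p̄(ξ) for all ξ ∈ (0, ξ₁). Suppose η satisfies the shock ODE η′(ξ) = (ξη(ξ) + √(p̄(ξ)(ξ² + η(ξ)² − p̄(ξ))))/(ξ² − p̄(ξ)) on (0, ξ₁). Then η″(ξ) ≥ 0 for all ξ ∈ (0, ξ₁); that is, the shock curve ξ ↦ η(ξ) is convex, and it is strictly convex on any subinterval where p̄′ > 0 and η√p̄ + ξ√(ξ²+η²−p̄) ≠ 0. -/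
open Real Set

/-- Convexity of the diffracted shock: if `η` solves the shock ODE
`η′ = (ξη + √(p̄(ξ² + η² − p̄)))/(ξ² − p̄)` on `(0, ξ₁)` with `p̄ > 0`
nondecreasing, then `η″ ≥ 0`, with strict inequality where `p̄′ > 0` and
`η√p̄ + ξ√(ξ² + η² − p̄) ≠ 0`. -/
theorem stmt9
    (ξ₁ : ℝ) (hξ₁ : 0 < ξ₁) (η pbar : ℝ → ℝ)
    (hη : ∀ ξ ∈ Set.Ioo (0 : ℝ) ξ₁, DifferentiableAt ℝ η ξ ∧ DifferentiableAt ℝ (deriv η) ξ)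
    (hpbar : ∀ ξ ∈ Set.Ioo (0 : ℝ) ξ₁, DifferentiableAt ℝ pbar ξ)
    (hpos : ∀ ξ ∈ Set.Ioo (0 : ℝ) ξ₁, 0 < pbar ξ)
    (hmono : ∀ ξ ∈ Set.Ioo (0 : ℝ) ξ₁, 0 ≤ deriv pbar ξ)
    (hne : ∀ ξ ∈ Set.Ioo (0 : ℝ) ξ₁, ξ ^ 2 ≠ pbar ξ)
    (hsup : ∀ ξ ∈ Set.Ioo (0 : ℝ) ξ₁, pbar ξ < ξ ^ 2 + (η ξ) ^ 2)
    (hode : ∀ ξ ∈ Set.Ioo (0 : ℝ) ξ₁,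
      deriv η ξ = (ξ * η ξ + Real.sqrt (pbar ξ * (ξ ^ 2 + (η ξ) ^ 2 - pbar ξ)))
        / (ξ ^ 2 - pbar ξ)) :
    ∀ ξ ∈ Set.Ioo (0 : ℝ) ξ₁,
      0 ≤ deriv (deriv η) ξ ∧
      (0 < deriv pbar ξ →
        η ξ * Real.sqrt (pbar ξ) + ξ * Real.sqrt (ξ ^ 2 + (η ξ) ^ 2 - pbar ξ) ≠ 0 →
        0 < deriv (deriv η) ξ) := by
  intro ξ hξ
  have hq : ∀ x ∈ Set.Ioo (0 : ℝ) ξ₁,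
      (x * deriv η x - η x) ^ 2 - pbar x * (1 + (deriv η x) ^ 2) = 0 := by
    intro x hx
    have hd : x ^ 2 - pbar x ≠ 0 := sub_ne_zero.mpr (hne x hx)
    have hS := Real.sq_sqrt (mul_nonneg (hpos x hx).le (sub_pos.mpr (hsup x hx)).le)
    have ho := (eq_div_iff hd).mp (hode x hx)
    set S := Real.sqrt (pbar x * (x ^ 2 + (η x) ^ 2 - pbar x))
    set m := deriv η x
    have hS' : S = m * (x ^ 2 - pbar x) - x * η x := by linarith
    rw [hS'] at hS
    apply mul_left_cancel₀ hd
    linear_combination hS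
  have hd : ξ ^ 2 - pbar ξ ≠ 0 := sub_ne_zero.mpr (hne ξ hξ)
  have hSpos := Real.sqrt_pos.mpr (mul_pos (hpos ξ hξ) (sub_pos.mpr (hsup ξ hξ)))
  have ho := (eq_div_iff hd).mp (hode ξ hξ)
  have h1 := (hη ξ hξ).1.hasDerivAt
  have h2 := (hη ξ hξ).2.hasDerivAt
  have h3 := (hpbar ξ hξ).hasDerivAt
  have hD := ((((hasDerivAt_id' ξ).fun_mul h2).fun_sub h1).fun_pow 2).fun_sub
    (h3.fun_mul ((h2.fun_pow 2).const_add 1))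
  have hev : (fun x => (x * deriv η x - η x) ^ 2 - pbar x * (1 + (deriv η x) ^ 2))
      =ᶠ[nhds ξ] fun _ => (0 : ℝ) := by
    filter_upwards [Ioo_mem_nhds hξ.1 hξ.2] with x hx using hq x hx
  have h0 := hD.unique ((hasDerivAt_const ξ (0 : ℝ)).congr_of_eventuallyEq hev)
  set S := Real.sqrt (pbar ξ * (ξ ^ 2 + (η ξ) ^ 2 - pbar ξ))
  set m := deriv η ξ
  have key : deriv (deriv η) ξ = deriv pbar ξ * (1 + m ^ 2) / (2 * S) := by
    rw [eq_div_iff (by positivity)]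
    norm_num at h0
    linear_combination h0 - 2 * deriv (deriv η) ξ * ho
  have hm := hmono ξ hξ
  rw [key]
  exact ⟨by positivity, fun hp _ => by positivity⟩
end

section
/- Fix p̄ > 0 and define f(ξ, η) = (ξη + √(p̄(ξ² + η² − p̄)))/(ξ² − p̄) on the open set D = {(ξ,η) ∈ ℝ² : ξ² + η² > p̄ and ξ² ≠ p̄}. Then f is differentiable on D and satisfies the identity ∂f/∂ξ (ξ,η) + f(ξ,η) · ∂f/∂η (ξ,η) = 0 for all (ξ,η) ∈ D. -/
open Real Set

/-- The shock-slope function `f(ξ,η) = (ξη + √(p̄(ξ²+η²−p̄)))/(ξ² − p̄)` is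
differentiable on `D = {ξ²+η² > p̄, ξ² ≠ p̄}` and satisfies
`f_ξ + f·f_η = 0` there. -/
theorem stmt10
    (pbar : ℝ) (hpbar : 0 < pbar)
    (f : ℝ × ℝ → ℝ)
    (hf : f = fun z =>
      (z.1 * z.2 + Real.sqrt (pbar * (z.1 ^ 2 + z.2 ^ 2 - pbar))) / (z.1 ^ 2 - pbar))
    (D : Set (ℝ × ℝ))
    (hD : D = {z : ℝ × ℝ | pbar < z.1 ^ 2 + z.2 ^ 2 ∧ z.1 ^ 2 ≠ pbar}) :
    ∀ z ∈ D, DifferentiableAt ℝ f z ∧ pdx f z + f z * pdy f z = 0 := by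
  subst hf hD
  rintro ⟨x, y⟩ ⟨h1, h2⟩
  simp only at h1 h2
  have hR : 0 < pbar * (x ^ 2 + y ^ 2 - pbar) := mul_pos hpbar (by linarith)
  have hQ : x ^ 2 - pbar ≠ 0 := sub_ne_zero.mpr h2
  set F : ℝ × ℝ → ℝ := fun z =>
      (z.1 * z.2 + Real.sqrt (pbar * (z.1 ^ 2 + z.2 ^ 2 - pbar))) / (z.1 ^ 2 - pbar) with hF
  have hd : DifferentiableAt ℝ F (x, y) := by
    simp only [hF, div_eq_mul_inv]
    refine DifferentiableAt.fun_mul ?_ (DifferentiableAt.fun_inv (by fun_prop) hQ)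
    · apply DifferentiableAt.add (by fun_prop)
      exact DifferentiableAt.sqrt (by fun_prop) hR.ne'
  refine ⟨hd, ?_⟩
  have hS : 0 < Real.sqrt (pbar * (x ^ 2 + y ^ 2 - pbar)) := Real.sqrt_pos.mpr hR
  have hS2 := Real.sq_sqrt hR.le
  have ex : pdx F (x, y) = ((y + pbar * (2 * x) / (2 * Real.sqrt (pbar * (x ^ 2 + y ^ 2 - pbar)))) * (x ^ 2 - pbar)
      - (x * y + Real.sqrt (pbar * (x ^ 2 + y ^ 2 - pbar))) * (2 * x)) / (x ^ 2 - pbar) ^ 2 := by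
    have hc : HasDerivAt (fun t : ℝ => (t, y)) ((1 : ℝ), (0 : ℝ)) x :=
      (hasDerivAt_id x).prodMk (hasDerivAt_const x y)
    have a := HasFDerivAt.comp_hasDerivAt x hd.hasFDerivAt hc
    have q : HasDerivAt (fun t : ℝ => t ^ 2) (2 * x) x := by simpa using hasDerivAt_pow 2 x
    have b := (((hasDerivAt_id x).mul_const y).add
      ((((q.add_const (y ^ 2)).sub_const pbar).const_mul pbar).sqrt hR.ne')).div
        (q.sub_const pbar) hQ
    have e := a.unique b
    simpa [pdx] using e
  have ey : pdy F (x, y) = (x + pbar * (2 * y) / (2 * Real.sqrt (pbar * (x ^ 2 + y ^ 2 - pbar)))) / (x ^ 2 - pbar) := by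
    have hc : HasDerivAt (fun t : ℝ => (x, t)) ((0 : ℝ), (1 : ℝ)) y :=
      (hasDerivAt_const y x).prodMk (hasDerivAt_id y)
    have a := HasFDerivAt.comp_hasDerivAt y hd.hasFDerivAt hc
    have q : HasDerivAt (fun t : ℝ => t ^ 2) (2 * y) y := by simpa using hasDerivAt_pow 2 y
    have b := (((hasDerivAt_id y).const_mul x).add
      ((((q.const_add (x ^ 2)).sub_const pbar).const_mul pbar).sqrt hR.ne')).div_const
        (x ^ 2 - pbar)
    have e := a.unique b
    simpa [pdy] using e
  rw [ex, ey]
  simp only [hF]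
  generalize Real.sqrt (pbar * (x ^ 2 + y ^ 2 - pbar)) = S at hS hS2
  have hS' := hS.ne'
  have key : ((y + pbar * (2 * x) / (2 * S)) * (x ^ 2 - pbar) - (x * y + S) * (2 * x)) / (x ^ 2 - pbar) ^ 2
      + (x * y + S) / (x ^ 2 - pbar) * ((x + pbar * (2 * y) / (2 * S)) / (x ^ 2 - pbar))
      = x * (pbar * (x ^ 2 + y ^ 2 - pbar) - S ^ 2) / (S * (x ^ 2 - pbar) ^ 2) := by
    field_simp
    ring
  rw [key, hS2]
  simp
end

section
/- For ξ, η ∈ ℝ and p̄ > 0 with ξ² + η² > p̄ and ξ² ≠ p̄, define f(ξ, η, p̄) = (ξη + √(p̄(ξ² + η² − p̄)))/(ξ² − p̄). Then f is differentiable in p̄ and ∂f/∂p̄ = (η√p̄ + ξ√(ξ² + η² − p̄))² / (2(ξ² − p̄)² √(p̄(ξ² + η² − p̄))). In particular ∂f/∂p̄ ≥ 0, with strict inequality whenever η√p̄ + ξ√(ξ² + η² − p̄) ≠ 0. -/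
open Real

/-- Monotonicity of the shock-slope function in the average pressure:
`∂f/∂p̄ = (η√p̄ + ξ√(ξ²+η²−p̄))²/(2(ξ²−p̄)²√(p̄(ξ²+η²−p̄))) ≥ 0`, with strict
inequality when `η√p̄ + ξ√(ξ²+η²−p̄) ≠ 0`. -/
theorem stmt11
    (ξ η pbar : ℝ) (hpbar : 0 < pbar) (hsup : pbar < ξ ^ 2 + η ^ 2) (hne : ξ ^ 2 ≠ pbar)
    (f : ℝ → ℝ)
    (hf : f = fun t => (ξ * η + Real.sqrt (t * (ξ ^ 2 + η ^ 2 - t))) / (ξ ^ 2 - t)) :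
    HasDerivAt f
      ((η * Real.sqrt pbar + ξ * Real.sqrt (ξ ^ 2 + η ^ 2 - pbar)) ^ 2 /
        (2 * (ξ ^ 2 - pbar) ^ 2 * Real.sqrt (pbar * (ξ ^ 2 + η ^ 2 - pbar)))) pbar ∧
    0 ≤ (η * Real.sqrt pbar + ξ * Real.sqrt (ξ ^ 2 + η ^ 2 - pbar)) ^ 2 /
        (2 * (ξ ^ 2 - pbar) ^ 2 * Real.sqrt (pbar * (ξ ^ 2 + η ^ 2 - pbar))) ∧
    (η * Real.sqrt pbar + ξ * Real.sqrt (ξ ^ 2 + η ^ 2 - pbar) ≠ 0 →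
      0 < (η * Real.sqrt pbar + ξ * Real.sqrt (ξ ^ 2 + η ^ 2 - pbar)) ^ 2 /
        (2 * (ξ ^ 2 - pbar) ^ 2 * Real.sqrt (pbar * (ξ ^ 2 + η ^ 2 - pbar)))) := by
  have hq : 0 < ξ ^ 2 + η ^ 2 - pbar := by linarith
  have hd : ξ ^ 2 - pbar ≠ 0 := sub_ne_zero.mpr hne
  have hpq : 0 < pbar * (ξ ^ 2 + η ^ 2 - pbar) := mul_pos hpbar hq
  have hs : 0 < Real.sqrt (pbar * (ξ ^ 2 + η ^ 2 - pbar)) := Real.sqrt_pos.mpr hpq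
  have hd2 : 0 < (ξ ^ 2 - pbar) ^ 2 := by positivity
  have hden : 0 < 2 * (ξ ^ 2 - pbar) ^ 2 * Real.sqrt (pbar * (ξ ^ 2 + η ^ 2 - pbar)) := by
    positivity
  refine ⟨?_, div_nonneg (sq_nonneg _) hden.le, fun h => div_pos (by positivity) hden⟩
  have h1 : HasDerivAt (fun t : ℝ => ξ ^ 2 + η ^ 2 - t) (-1) pbar :=
    (hasDerivAt_id' pbar).const_sub _
  have h2 : HasDerivAt (fun t : ℝ => ξ ^ 2 - t) (-1) pbar :=
    (hasDerivAt_id' pbar).const_sub _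
  have h3 : HasDerivAt (fun t : ℝ => t * (ξ ^ 2 + η ^ 2 - t))
      (1 * (ξ ^ 2 + η ^ 2 - pbar) + pbar * (-1)) pbar := (hasDerivAt_id' pbar).mul h1
  have h4 := ((h3.sqrt hpq.ne').const_add (ξ * η)).div h2 hd
  rw [hf]
  refine h4.congr_deriv ?_
  have hm : Real.sqrt (pbar * (ξ ^ 2 + η ^ 2 - pbar))
      = Real.sqrt pbar * Real.sqrt (ξ ^ 2 + η ^ 2 - pbar) := Real.sqrt_mul hpbar.le _
  have ha := Real.sq_sqrt hpbar.le
  have hb := Real.sq_sqrt hq.le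
  have hss := Real.sq_sqrt hpq.le
  generalize Real.sqrt (pbar * (ξ ^ 2 + η ^ 2 - pbar)) = s at *
  generalize Real.sqrt pbar = a at *
  generalize Real.sqrt (ξ ^ 2 + η ^ 2 - pbar) = b at *
  have hs0 := hs.ne'
  have e : (η * a + ξ * b) ^ 2 = (ξ ^ 2 + η ^ 2 - pbar - pbar) * (ξ ^ 2 - pbar)
      + 2 * s * (ξ * η + s) := by
    linear_combination η ^ 2 * ha + ξ ^ 2 * hb - 2 * hss - 2 * ξ * η * hm
  rw [e]
  field_simp
  ring
end

section
/- Let p₁ > p₂ > 0, let Ω ⊂ ℝ² be an open set whose boundary contains a nonempty relatively open arc Γ_sonic of the circle {ξ² + η² = p₁}, and let p ∈ C²(Ω) ∩ C(Ω̄) satisfy the second-order pressure equation (p − ξ²) p_{ξξ} − 2ξη p_{ξη} + (p − η²) p_{ηη} + (ξ p_ξ + η p_η)²/p − 2(ξ p_ξ + η p_η) = 0 in Ω, together with p₂ < p < p₁ and ξ² + η² < p in Ω, and p = p₁ on Γ_sonic. Then p cannot be C¹ across Γ_sonic: there is no open set N ⊆ ℝ² meeting Γ_sonic and no continuously differentiable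 function q on N with q = p on N ∩ Ω and q = p₁ on N \ Ω. -/
open Real Set

lemma aux_second (f f' : ℝ → ℝ) (c : ℝ) (hf : ∀ᶠ t in nhds (0:ℝ), HasDerivAt f (f' t) t)
    (hf' : HasDerivAt f' c 0) (hm : IsLocalMax f 0) : f' 0 = 0 ∧ c ≤ 0 := by
  have h0 : f' 0 = 0 := hm.hasDerivAt_eq_zero hf.self_of_nhds
  refine ⟨h0, ?_⟩
  by_contra hc
  push Not at hc
  have e1 : deriv f =ᶠ[nhds 0] f' := hf.mono fun t ht => ht.deriv
  have d2 : deriv (deriv f) 0 = c := by rw [e1.deriv_eq]; exact hf'.deriv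
  have hmin : IsLocalMin f 0 := isLocalMin_of_deriv_deriv_pos (by rw [d2]; exact hc)
    (by rw [e1.self_of_nhds, h0]) hf.self_of_nhds.continuousAt
  have hconst : f =ᶠ[nhds 0] fun _ => f 0 := by
    filter_upwards [hmin, hm] with t h1 h2 using le_antisymm h2 h1
  have : deriv f =ᶠ[nhds 0] fun _ => 0 := by
    have := hconst.deriv
    simpa using this
  have h3 := this.deriv_eq
  rw [d2] at h3
  simp at h3
  linarith

lemma aux_exp (f f' ψ ψ' : ℝ → ℝ) (c c2 ε α : ℝ)
    (hf : ∀ᶠ t in nhds (0:ℝ), HasDerivAt f (f' t) t)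
    (hf' : HasDerivAt f' c2 0) (hψ : ∀ t, HasDerivAt ψ (ψ' t) t) (hψ' : HasDerivAt ψ' c 0)
    (hm : IsLocalMax (fun t => f t + ε * exp (-α * ψ t)) 0) :
    f' 0 = ε * α * exp (-α * ψ 0) * ψ' 0 ∧
    c2 ≤ - (ε * α * exp (-α * ψ 0) * (α * ψ' 0 ^ 2 - c)) := by
  have hE : ∀ t, HasDerivAt (fun t => exp (-α * ψ t)) (exp (-α * ψ t) * (-α * ψ' t)) t :=
    fun t => ((hψ t).const_mul (-α)).exp
  have := aux_second _ (fun t => f' t + ε * (exp (-α * ψ t) * (-α * ψ' t)))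
    (c2 + ε * ((exp (-α * ψ 0) * (-α * ψ' 0)) * (-α * ψ' 0) + exp (-α * ψ 0) * (-α * c)))
    (hf.mono fun t ht => ht.add ((hE t).const_mul ε))
    (hf'.add (((hE 0).mul (hψ'.const_mul (-α))).const_mul ε)) hm
  constructor
  · linarith [this.1]
  · nlinarith [this.2]

lemma aux_pd (p : ℝ × ℝ → ℝ) (z v : ℝ × ℝ) : fderiv ℝ p z v = v.1 * pdx p z + v.2 * pdy p z := by
  have : v = v.1 • ((1:ℝ), (0:ℝ)) + v.2 • ((0:ℝ), (1:ℝ)) := by ext <;> simp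
  conv_lhs => rw [this]
  rw [map_add, map_smul, map_smul]; rfl

/-- second derivatives along a line -/
lemma aux_line (p : ℝ × ℝ → ℝ) (Ω : Set (ℝ × ℝ)) (hΩ : IsOpen Ω) (hreg : ContDiffOn ℝ 2 p Ω)
    (z v : ℝ × ℝ) (hz : z ∈ Ω) :
    (∀ᶠ t in nhds (0:ℝ), HasDerivAt (fun t : ℝ => p (z + t • v)) (fderiv ℝ p (z + t • v) v) t) ∧
    HasDerivAt (fun t : ℝ => fderiv ℝ p (z + t • v) v)
      (v.1 ^ 2 * pdx (pdx p) z + 2 * v.1 * v.2 * pdy (pdx p) z + v.2 ^ 2 * pdy (pdy p) z) 0 := by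
  have hl : ∀ t : ℝ, HasDerivAt (fun t : ℝ => z + t • v) v t := fun t => by
    simpa using ((hasDerivAt_id t).smul_const v).const_add z
  have hp : ContDiffAt ℝ 2 p z := hreg.contDiffAt (hΩ.mem_nhds hz)
  have hd : DifferentiableAt ℝ (fderiv ℝ p) z :=
    (hp.fderiv_right (m := 1) (by norm_num)).differentiableAt (by norm_num)
  have hsym : IsSymmSndFDerivAt ℝ p z := hp.isSymmSndFDerivAt (by simp)
  have key : ∀ a b : ℝ × ℝ, fderiv ℝ (fun y => fderiv ℝ p y a) z b
      = fderiv ℝ (fderiv ℝ p) z b a := by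
    intro a b
    have := (hd.hasFDerivAt.clm_apply (hasFDerivAt_const a z)).fderiv
    rw [this]; simp
  constructor
  · have : ∀ᶠ t in nhds (0:ℝ), z + t • v ∈ Ω := by
      apply (hl 0).continuousAt.eventually
      apply hΩ.mem_nhds; simpa using hz
    filter_upwards [this] with t ht
    have h1 : DifferentiableAt ℝ p (z + t • v) :=
      (hreg.contDiffAt (hΩ.mem_nhds ht)).differentiableAt (by norm_num)
    exact h1.hasFDerivAt.comp_hasDerivAt t (hl t)
  · have hd' : HasFDerivAt (fun y => fderiv ℝ p y v) (fderiv ℝ (fun y => fderiv ℝ p y v) z)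
        (z + (0:ℝ) • v) := by
      have := (hd.clm_apply (differentiableAt_const v)).hasFDerivAt
      simpa using this
    have h2 := hd'.comp_hasDerivAt (0:ℝ) (hl 0)
    refine h2.congr_deriv ?_
    symm
    rw [key]
    have e1 : pdx (pdx p) z = fderiv ℝ (fderiv ℝ p) z (1,0) (1,0) := key _ _
    have e2 : pdy (pdx p) z = fderiv ℝ (fderiv ℝ p) z (0,1) (1,0) := key _ _
    have e3 : pdy (pdy p) z = fderiv ℝ (fderiv ℝ p) z (0,1) (0,1) := key _ _
    have e4 : fderiv ℝ (fderiv ℝ p) z (1,0) (0,1) = fderiv ℝ (fderiv ℝ p) z (0,1) (1,0) :=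
      hsym _ _
    rw [e1, e2, e3]
    have : v = v.1 • ((1:ℝ), (0:ℝ)) + v.2 • ((0:ℝ), (1:ℝ)) := by ext <;> simp
    conv_rhs => rw [this]
    simp only [map_add, map_smul, add_apply, smul_apply,
      smul_eq_mul, e4]
    ring

lemma aux_alpha (K : Set (ℝ × ℝ)) (hK : IsCompact K) (g h : ℝ × ℝ → ℝ) (hg : ContinuousOn g K)
    (hh : ContinuousOn h K) (g0 : ∀ z ∈ K, 0 ≤ g z) (h0 : ∀ z ∈ K, g z = 0 → 0 < h z) :
    ∃ α : ℝ, 0 < α ∧ ∀ z ∈ K, 0 < α * g z + h z := by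
  by_contra hc
  push Not at hc
  have : ∀ n : ℕ, ∃ z ∈ K, ((n:ℝ)+1) * g z + h z ≤ 0 := fun n => hc _ (by positivity)
  choose x xK hx using this
  obtain ⟨a, aK, φ, hφ, hlim⟩ := hK.tendsto_subseq xK
  have hlim' : Filter.Tendsto (x ∘ φ) Filter.atTop (nhdsWithin a K) :=
    tendsto_nhdsWithin_iff.2 ⟨hlim, Filter.Eventually.of_forall fun n => xK _⟩
  have hgl := (hg a aK).tendsto.comp hlim'
  have hhl := (hh a aK).tendsto.comp hlim'
  have hha : h a ≤ 0 := by
    refine le_of_tendsto hhl (Filter.Eventually.of_forall fun n => ?_)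
    have h1 := hx (φ n)
    have h2 := g0 _ (xK (φ n))
    have : 0 ≤ ((φ n : ℝ)+1) * g (x (φ n)) := by positivity
    simp only [Function.comp]; linarith
  have hga : 0 < g a := lt_of_le_of_ne (g0 a aK) fun h => absurd (h0 a aK h.symm) (not_lt.2 hha)
  have htop : Filter.Tendsto (fun n => ((φ n : ℝ) + 1) * g (x (φ n))) Filter.atTop Filter.atTop := by
    refine Filter.Tendsto.atTop_mul_pos hga ?_ hgl
    exact Filter.tendsto_atTop_add_const_right _ _
      (tendsto_natCast_atTop_atTop.comp hφ.tendsto_atTop)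
  have := Filter.Tendsto.atTop_add htop hhl
  obtain ⟨n, hn⟩ := (this.eventually_gt_atTop 0).exists
  exact absurd (hx (φ n)) (not_le.2 hn)

/-- geometric facts about the comparison region -/
lemma aux_geom (p₁ A R k r S T X : ℝ) (hR : R = p₁ - A) (hA : 0 < A) (hA3 : 3 * A < p₁)
    (hk : k * R = A) (hk0 : 0 < k) (hX : X = p₁ - r) (hST : S ^ 2 + T ^ 2 = r * R) (hS : 0 ≤ S)
    (hΦ : (X - A) ^ 2 + k * T ^ 2 ≤ A ^ 2) :
    0 ≤ X ∧ X ≤ 2 * A ∧ p₁ - 3 * A ≤ S ∧ r + R - 2 * S ≤ 5 * A := by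
  have hkT : 0 ≤ k * T ^ 2 := by positivity
  have h1 : (X - A) ^ 2 ≤ A ^ 2 := by linarith
  have h2 := abs_le.1 (abs_le_of_sq_le_sq h1 hA.le)
  have hX0 : 0 ≤ X := by linarith [h2.1]
  have hX2 : X ≤ 2 * A := by linarith [h2.2]
  have hR0 : 0 < R := by linarith
  have hT : T ^ 2 ≤ A * R := by
    have : k * T ^ 2 ≤ k * (A * R) := by
      have : k * (A * R) = A ^ 2 := by rw [mul_comm A R, ← mul_assoc, hk]; ring
      nlinarith [sq_nonneg (X - A)]
    exact le_of_mul_le_mul_left this hk0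
  have hSlow : p₁ - 3 * A ≤ S := by
    apply abs_le_of_sq_le_sq' _ hS |>.2
    nlinarith
  refine ⟨hX0, hX2, hSlow, ?_⟩
  linarith

lemma aux_crit (p₁ A R r S T X k : ℝ) (hR : R = p₁ - A) (hX : X = p₁ - r)
    (hr : 0 < r) (hk0 : 0 < k) (hS : 0 < S)
    (h1 : 4 * r * (A - X) + 2 * k * T ^ 2 = 0) (h2 : 2 * k * T * S = 0) :
    T = 0 ∧ r = R := by
  have hT : T = 0 := by
    rcases mul_eq_zero.1 h2 with h | h
    · rcases mul_eq_zero.1 h with h | h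
      · linarith
      · exact h
    · linarith
  refine ⟨hT, ?_⟩
  rw [hT] at h1
  have : r * (A - X) = 0 := by linarith
  rcases mul_eq_zero.1 this with h | h <;> linarith

lemma aux_sq (a b : ℝ) (h : a ^ 2 + b ^ 2 = 0) : a = 0 ∧ b = 0 := by
  constructor <;> nlinarith [sq_nonneg a, sq_nonneg b]

set_option maxHeartbeats 4000000

/-- A solution of the second-order pressure equation in the subsonic region,
with `p₂ < p < p₁`, `ξ² + η² < p`, and `p = p₁` on a relatively open arc
`Γ_sonic` of the sonic circle contained in the boundary, cannot be `C¹` across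
the degenerate sonic boundary. -/
theorem stmt13
    (p₁ p₂ : ℝ) (h12 : p₁ > p₂) (h2 : p₂ > 0)
    (Ω : Set (ℝ × ℝ)) (hΩ : IsOpen Ω)
    (Γ : Set (ℝ × ℝ)) (hΓne : Γ.Nonempty)
    (hΓcirc : Γ ⊆ {z : ℝ × ℝ | z.1 ^ 2 + z.2 ^ 2 = p₁})
    (hΓrelopen : ∃ W : Set (ℝ × ℝ), IsOpen W ∧ Γ = W ∩ {z : ℝ × ℝ | z.1 ^ 2 + z.2 ^ 2 = p₁})
    (hΓbd : Γ ⊆ frontier Ω)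
    (p : ℝ × ℝ → ℝ)
    (hreg : ContDiffOn ℝ 2 p Ω) (hcont : ContinuousOn p (closure Ω))
    (hpde : ∀ z ∈ Ω,
      (p z - z.1 ^ 2) * pdx (pdx p) z - 2 * z.1 * z.2 * pdy (pdx p) z
        + (p z - z.2 ^ 2) * pdy (pdy p) z
        + (z.1 * pdx p z + z.2 * pdy p z) ^ 2 / p z
        - 2 * (z.1 * pdx p z + z.2 * pdy p z) = 0)
    (hbnd : ∀ z ∈ Ω, p₂ < p z ∧ p z < p₁ ∧ z.1 ^ 2 + z.2 ^ 2 < p z)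
    (hson : ∀ z ∈ Γ, p z = p₁) :
    ¬ ∃ (N : Set (ℝ × ℝ)) (q : ℝ × ℝ → ℝ), IsOpen N ∧ (N ∩ Γ).Nonempty ∧
        ContDiffOn ℝ 1 q N ∧ (∀ z ∈ N ∩ Ω, q z = p z) ∧ (∀ z ∈ N \ Ω, q z = p₁) := by
  rintro ⟨N, q, hN, ⟨P0, hP0N, hP0Γ⟩, hq1, hqp, hqo⟩
  have hp1 : 0 < p₁ := by linarith
  have hP0c : P0.1 ^ 2 + P0.2 ^ 2 = p₁ := hΓcirc hP0Γ
  have hP0cl : P0 ∈ closure Ω := frontier_subset_closure (hΓbd hP0Γ)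
  -- basic facts on q
  have hqle : ∀ z ∈ N, q z ≤ p₁ := by
    intro z hz
    by_cases h : z ∈ Ω
    · rw [hqp z ⟨hz, h⟩]; exact (hbnd z h).2.1.le
    · rw [hqo z ⟨hz, h⟩]
  have hqpos : ∀ z ∈ N, 0 < q z := by
    intro z hz
    by_cases h : z ∈ Ω
    · rw [hqp z ⟨hz, h⟩]; linarith [(hbnd z h).1]
    · rw [hqo z ⟨hz, h⟩]; exact hp1
  have hqd : ∀ z ∈ N, DifferentiableAt ℝ q z := fun z hz =>
    (hq1.contDiffAt (hN.mem_nhds hz)).differentiableAt (by norm_num)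
  have hqgrad : ∀ z ∈ N, z ∉ Ω → fderiv ℝ q z = 0 := by
    intro z hz h
    have : IsLocalMax q z := by
      filter_upwards [hN.mem_nhds hz] with y hy
      rw [hqo z ⟨hz, h⟩]; exact hqle y hy
    exact this.fderiv_eq_zero
  have hqf : ContinuousOn (fderiv ℝ q) N := hq1.continuousOn_fderiv_of_isOpen hN (by norm_num)
  have hqc : ContinuousOn q N := hq1.continuousOn
  -- choose P
  obtain ⟨δ, δ0, hδ⟩ := Metric.isOpen_iff.1 hN P0 hP0N
  obtain ⟨P, hPΩ, hPδ, hPA1, hPA2⟩ : ∃ P ∈ Ω, dist P P0 < δ / 2 ∧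
      5 * (p₁ - (P.1 ^ 2 + P.2 ^ 2)) < (δ / 2) ^ 2 ∧ 3 * (p₁ - (P.1 ^ 2 + P.2 ^ 2)) < p₁ := by
    have c : Continuous fun P : ℝ × ℝ => p₁ - (P.1 ^ 2 + P.2 ^ 2) := by fun_prop
    have e1 : ∀ᶠ P in nhds P0, dist P P0 < δ / 2 := Metric.ball_mem_nhds _ (by positivity)
    have e2 : ∀ᶠ P : ℝ × ℝ in nhds P0, 5 * (p₁ - (P.1 ^ 2 + P.2 ^ 2)) < (δ / 2) ^ 2 :=
      (continuous_const.mul c).continuousAt.eventually_lt continuousAt_const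
        (by
        simp only [Pi.mul_apply]
        rw [hP0c, sub_self, mul_zero]; positivity)
    have e3 : ∀ᶠ P : ℝ × ℝ in nhds P0, 3 * (p₁ - (P.1 ^ 2 + P.2 ^ 2)) < p₁ :=
      (continuous_const.mul c).continuousAt.eventually_lt continuousAt_const
        (by
        simp only [Pi.mul_apply]
        rw [hP0c, sub_self, mul_zero]; exact hp1)
    obtain ⟨P, h1, h2⟩ := ((mem_closure_iff_frequently.1 hP0cl).and_eventually
      (e1.and (e2.and e3))).exists
    exact ⟨P, h1, h2.1, h2.2.1, h2.2.2⟩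
  obtain ⟨R, hRdef⟩ : ∃ R, R = P.1 ^ 2 + P.2 ^ 2 := ⟨_, rfl⟩
  rw [← hRdef] at hPA1 hPA2
  obtain ⟨A, hAdef⟩ : ∃ A, A = p₁ - R := ⟨_, rfl⟩
  rw [← hAdef] at hPA1 hPA2
  have hRA : R = p₁ - A := by linarith
  have hA : 0 < A := by have := hbnd P hPΩ; linarith [this.2.1, this.2.2]
  have hR0 : 0 < R := by linarith
  obtain ⟨k, hkdef⟩ : ∃ k, k = A / R := ⟨_, rfl⟩
  have hk0 : 0 < k := by rw [hkdef]; positivity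
  have hkR : k * R = A := by rw [hkdef]; field_simp
  -- closed ball around P
  obtain ⟨ρ, ρ0, hρ⟩ : ∃ ρ > 0, Metric.closedBall P ρ ⊆ Ω :=
    Metric.nhds_basis_closedBall.mem_iff.1 (hΩ.mem_nhds hPΩ)
  -- functions
  let r : ℝ × ℝ → ℝ := fun z => z.1 ^ 2 + z.2 ^ 2
  let S : ℝ × ℝ → ℝ := fun z => z.1 * P.1 + z.2 * P.2
  let T : ℝ × ℝ → ℝ := fun z => z.2 * P.1 - z.1 * P.2
  let X : ℝ × ℝ → ℝ := fun z => p₁ - r z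
  let Φ : ℝ × ℝ → ℝ := fun z => (X z - A) ^ 2 + k * T z ^ 2
  let Φz : ℝ × ℝ → ℝ := fun z => 4 * r z * (A - X z) + 2 * k * T z ^ 2
  let Φzz : ℝ × ℝ → ℝ := fun z => 8 * r z ^ 2 + 4 * r z * (A - X z) + 2 * k * T z ^ 2
  let Φo : ℝ × ℝ → ℝ := fun z => 2 * k * T z * S z
  let Φoo : ℝ × ℝ → ℝ := fun z => 4 * r z * (A - X z) + 2 * k * S z ^ 2
  have cr : Continuous r := by fun_prop
  have cS : Continuous S := by fun_prop
  have cT : Continuous T := by fun_prop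
  have cX : Continuous X := by fun_prop
  have cΦ : Continuous Φ := by fun_prop
  have cΦz : Continuous Φz := by fun_prop
  have cΦzz : Continuous Φzz := by fun_prop
  have cΦo : Continuous Φo := by fun_prop
  have cΦoo : Continuous Φoo := by fun_prop
  have hST : ∀ z, S z ^ 2 + T z ^ 2 = r z * R := fun z => by
    simp only [S, T, r, hRdef]; ring
  let K : Set (ℝ × ℝ) := {z | Φ z ≤ A ^ 2 ∧ 0 ≤ S z ∧ ρ ≤ dist z P}
  have hgeo : ∀ z ∈ K, 0 ≤ X z ∧ X z ≤ 2 * A ∧ p₁ - 3 * A ≤ S z ∧ r z + R - 2 * S z ≤ 5 * A :=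
    fun z hz => aux_geom p₁ A R k (r z) (S z) (T z) (X z) hRA hA hPA2 hkR hk0 rfl (hST z) hz.2.1 hz.1
  have hrpos : ∀ z ∈ K, 0 < r z := fun z hz => by
    have := (hgeo z hz).2.1
    simp only [X] at this; linarith
  have hSpos : ∀ z ∈ K, 0 < S z := fun z hz => by linarith [(hgeo z hz).2.2.1]
  have hKN : K ⊆ N := by
    intro z hz
    apply hδ
    have h5 := (hgeo z hz).2.2.2
    have hsq : (z.1 - P.1) ^ 2 + (z.2 - P.2) ^ 2 < (δ / 2) ^ 2 := by
      have : (z.1 - P.1) ^ 2 + (z.2 - P.2) ^ 2 = r z + R - 2 * S z := by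
        simp only [r, S, hRdef]; ring
      linarith
    have hd : dist z P < δ / 2 := by
      rw [Prod.dist_eq, max_lt_iff, Real.dist_eq, Real.dist_eq]
      constructor <;> apply abs_lt_of_sq_lt_sq _ (by positivity)
      · linarith [sq_nonneg (z.2 - P.2)]
      · linarith [sq_nonneg (z.1 - P.1)]
    rw [Metric.mem_ball]
    linarith [dist_triangle z P P0]
  have hKclosed : IsClosed K := by
    refine (isClosed_le cΦ continuous_const).inter ((isClosed_le continuous_const cS).inter
      (isClosed_le continuous_const (continuous_id.dist continuous_const)))
  have hK : IsCompact K := by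
    refine Metric.isCompact_of_isClosed_isBounded hKclosed ?_
    refine (Metric.isBounded_ball (x := P0) (r := δ)).subset ?_ 
    intro z hz
    have h5 := (hgeo z hz).2.2.2
    have hsq : (z.1 - P.1) ^ 2 + (z.2 - P.2) ^ 2 < (δ / 2) ^ 2 := by
      have : (z.1 - P.1) ^ 2 + (z.2 - P.2) ^ 2 = r z + R - 2 * S z := by
        simp only [r, S, hRdef]; ring
      linarith
    have hd : dist z P < δ / 2 := by
      rw [Prod.dist_eq, max_lt_iff, Real.dist_eq, Real.dist_eq]
      constructor <;> apply abs_lt_of_sq_lt_sq _ (by positivity)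
      · linarith [sq_nonneg (z.2 - P.2)]
      · linarith [sq_nonneg (z.1 - P.1)]
    rw [Metric.mem_ball]
    linarith [dist_triangle z P P0]
  -- no critical points of Φ in K
  have hcrit : ∀ z ∈ K, Φz z = 0 → Φo z = 0 → False := by
    intro z hz h1 h2
    obtain ⟨hT, hr⟩ := aux_crit p₁ A R (r z) (S z) (T z) (X z) k hRA rfl (hrpos z hz) hk0
      (hSpos z hz) h1 h2
    have hs := hST z
    rw [hT, hr] at hs
    have hSR : S z = R := by
      have h : (S z - R) * (S z + R) = 0 := by linarith
      rcases mul_eq_zero.1 h with h | h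
      · linarith
      · linarith [hSpos z hz]
    have : (z.1 - P.1) ^ 2 + (z.2 - P.2) ^ 2 = 0 := by
      have : (z.1 - P.1) ^ 2 + (z.2 - P.2) ^ 2 = r z + R - 2 * S z := by
        simp only [r, S, hRdef]; ring
      rw [this, hr, hSR]; ring
    obtain ⟨h1, h2⟩ := aux_sq _ _ this
    have : z = P := Prod.ext (by linarith) (by linarith)
    have h3 := hz.2.2
    rw [this, dist_self] at h3
    linarith
  -- choice of α
  let g : ℝ × ℝ → ℝ := fun z => (q z - r z) * Φz z ^ 2 + q z * Φo z ^ 2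
  let h : ℝ × ℝ → ℝ := fun z => - (q z - r z) * Φzz z - q z * Φoo z
    + r z * (2 - fderiv ℝ q z z / q z) * Φz z
  have hdK : ∀ z ∈ K, 0 ≤ q z - r z := by
    intro z hz
    by_cases hzΩ : z ∈ Ω
    · rw [hqp z ⟨hKN hz, hzΩ⟩]; linarith [(hbnd z hzΩ).2.2]
    · rw [hqo z ⟨hKN hz, hzΩ⟩]; exact (hgeo z hz).1
  have hqcK : ContinuousOn q K := hqc.mono hKN
  have hgc : ContinuousOn g K := by fun_prop
  have hhc : ContinuousOn h K := by
    have h1 : ContinuousOn (fun z => fderiv ℝ q z z) K :=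
      (hqf.mono hKN).clm_apply continuousOn_id
    have h2 : ContinuousOn (fun z => fderiv ℝ q z z / q z) K :=
      h1.div hqcK fun z hz => (hqpos z (hKN hz)).ne'
    fun_prop
  have hg0 : ∀ z ∈ K, 0 ≤ g z := fun z hz => by
    have h1 := hdK z hz
    have h2 := hqpos z (hKN hz)
    simp only [g]; positivity
  have hh0 : ∀ z ∈ K, g z = 0 → 0 < h z := by
    intro z hz hgz
    have h1 := hdK z hz
    have h2 := hqpos z (hKN hz)
    have h3 : 0 ≤ (q z - r z) * Φz z ^ 2 := by positivity
    have h4 : 0 ≤ q z * Φo z ^ 2 := by positivity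
    have h5 : (q z - r z) * Φz z ^ 2 = 0 := by simp only [g] at hgz; linarith
    have h6 : q z * Φo z ^ 2 = 0 := by simp only [g] at hgz; linarith
    have h7 : Φo z = 0 := by
      rcases mul_eq_zero.1 h6 with h | h
      · linarith
      · exact pow_eq_zero_iff (by norm_num) |>.1 h
    have h8 : q z - r z = 0 := by
      rcases mul_eq_zero.1 h5 with h | h
      · exact h
      · exact (hcrit z hz (pow_eq_zero_iff (by norm_num) |>.1 h) h7).elim
    have hzΩ : z ∉ Ω := by
      intro hzΩ
      rw [hqp z ⟨hKN hz, hzΩ⟩] at h8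
      have := (hbnd z hzΩ).2.2
      simp only [r] at h8; linarith
    have hqz : q z = p₁ := hqo z ⟨hKN hz, hzΩ⟩
    have hrz : r z = p₁ := by linarith
    have hT : T z = 0 := by
      simp only [Φo] at h7
      have := hSpos z hz
      rcases mul_eq_zero.1 h7 with h | h
      · rcases mul_eq_zero.1 h with h | h
        · linarith
        · exact h
      · linarith
    have hS2 := hST z
    rw [hT, hrz] at hS2
    have hS3 : k * S z ^ 2 = p₁ * A := by rw [← hkR]; linear_combination k * hS2
    have hXz : X z = 0 := by simp only [X]; linarith
    simp only [h, Φz, Φzz, Φoo]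
    rw [hqgrad z (hKN hz) hzΩ, hXz, hT, hqz, hrz, mul_assoc 2 k (S z ^ 2), hS3]
    simp
    nlinarith only [mul_pos (mul_pos hp1 hp1) hA]
  obtain ⟨α, α0, hα⟩ := aux_alpha K hK g h hgc hhc hg0 hh0
  -- choice of ε
  obtain ⟨ε, ε0, hε⟩ : ∃ ε > 0, ∀ z ∈ K, dist z P = ρ → q z + ε ≤ p₁ := by
    have hKs : IsCompact (K ∩ Metric.closedBall P ρ) := hK.inter_right Metric.isClosed_closedBall
    rcases (K ∩ Metric.closedBall P ρ).eq_empty_or_nonempty with he | hne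
    · refine ⟨1, one_pos, fun z hz hd => ?_⟩
      have : z ∈ K ∩ Metric.closedBall P ρ := ⟨hz, hd.le⟩
      rw [he] at this; exact this.elim
    · obtain ⟨m, hm, hmax⟩ := hKs.exists_isMaxOn hne (hqcK.mono inter_subset_left)
      refine ⟨p₁ - q m, ?_, fun z hz hd => ?_⟩
      · rw [hqp m ⟨hKN hm.1, hρ hm.2⟩]
        have := (hbnd m (hρ hm.2)).2.1
        simp; exact this
      · have : q z ≤ q m := hmax ⟨hz, hd.le⟩
        linarith
  -- comparison
  let w : ℝ × ℝ → ℝ := fun z => ε * exp (-α * Φ z)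
  have cw : Continuous w := by fun_prop
  have lineZ : ∀ (z : ℝ × ℝ) (t : ℝ), HasDerivAt (fun t : ℝ => Φ (z + t • z))
      (2 * (p₁ - (1 + t) ^ 2 * r z - A) * (-(2 * (1 + t) * r z)) + k * (2 * (1 + t)) * T z ^ 2) t := by
    intro z t
    have e : (fun t : ℝ => Φ (z + t • z)) =
        fun t => (p₁ - (1 + t) ^ 2 * r z - A) ^ 2 + k * (1 + t) ^ 2 * T z ^ 2 := by
      funext t
      simp only [Φ, X, r, T, Prod.fst_add, Prod.snd_add, Prod.smul_fst, Prod.smul_snd, smul_eq_mul]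
      ring
    rw [e]
    have h1 : HasDerivAt (fun t : ℝ => (1 + t) ^ 2) (2 * (1 + t)) t := by
      refine (((hasDerivAt_id t).const_add 1).pow 2).congr_deriv ?_
      simp
    have h2 := ((((h1.mul_const (r z)).const_sub p₁).sub_const A).pow 2).add
      ((h1.const_mul k).mul_const (T z ^ 2))
    refine h2.congr_deriv ?_
    simp
  have lineZ' : ∀ (z : ℝ × ℝ), HasDerivAt (fun t : ℝ => 
      2 * (p₁ - (1 + t) ^ 2 * r z - A) * (-(2 * (1 + t) * r z)) + k * (2 * (1 + t)) * T z ^ 2)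
      (Φzz z) 0 := by
    intro z
    have h0 : HasDerivAt (fun t : ℝ => 2 * (1 + t)) 2 0 := by
      simpa using ((hasDerivAt_id (0:ℝ)).const_add 1).const_mul 2
    have h1 : HasDerivAt (fun t : ℝ => (1 + t) ^ 2) (2 * (1 + 0)) 0 := by
      refine (((hasDerivAt_id (0:ℝ)).const_add 1).pow 2).congr_deriv ?_
      simp
    have h2 := (((((h1.mul_const (r z)).const_sub p₁).sub_const A).const_mul 2).mul
      ((h0.mul_const (r z)).neg)).add ((h0.const_mul k).mul_const (T z ^ 2))
    refine h2.congr_deriv ?_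
    simp only [Φzz, X, Pi.neg_apply]; ring
  have lineO : ∀ (z : ℝ × ℝ) (t : ℝ), HasDerivAt (fun t : ℝ => Φ (z + t • (-z.2, z.1)))
      (2 * (p₁ - r z * (1 + t ^ 2) - A) * (-(r z * (2 * t))) + k * (2 * (T z + t * S z) * S z)) t := by
    intro z t
    have e : (fun t : ℝ => Φ (z + t • (-z.2, z.1))) =
        fun t => (p₁ - r z * (1 + t ^ 2) - A) ^ 2 + k * (T z + t * S z) ^ 2 := by
      funext t
      simp only [Φ, X, r, T, S, Prod.fst_add, Prod.snd_add, Prod.smul_fst, Prod.smul_snd,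
        smul_eq_mul]
      ring
    rw [e]
    have h1 : HasDerivAt (fun t : ℝ => 1 + t ^ 2) (2 * t) t := by
      simpa using ((hasDerivAt_id t).pow 2).const_add 1
    have h3 : HasDerivAt (fun t : ℝ => T z + t * S z) (S z) t := by
      simpa using ((hasDerivAt_id t).mul_const (S z)).const_add (T z)
    have h2 := ((((h1.const_mul (r z)).const_sub p₁).sub_const A).pow 2).add
      ((h3.pow 2).const_mul k)
    refine h2.congr_deriv ?_
    simp
  have lineO' : ∀ (z : ℝ × ℝ), HasDerivAt (fun t : ℝ => 
      2 * (p₁ - r z * (1 + t ^ 2) - A) * (-(r z * (2 * t))) + k * (2 * (T z + t * S z) * S z))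
      (Φoo z) 0 := by
    intro z
    have h0 : HasDerivAt (fun t : ℝ => 2 * t) 2 0 := by
      simpa using (hasDerivAt_id (0:ℝ)).const_mul 2
    have h1 : HasDerivAt (fun t : ℝ => 1 + t ^ 2) (2 * 0) 0 := by
      simpa using ((hasDerivAt_id (0:ℝ)).pow 2).const_add 1
    have h3 : HasDerivAt (fun t : ℝ => T z + t * S z) (S z) 0 := by
      simpa using ((hasDerivAt_id (0:ℝ)).mul_const (S z)).const_add (T z)
    have h2 := (((((h1.const_mul (r z)).const_sub p₁).sub_const A).const_mul 2).mul
      ((h0.const_mul (r z)).neg)).add (((h3.const_mul 2).mul_const (S z)).const_mul k)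
    refine h2.congr_deriv ?_
    simp only [Φoo, X, Pi.neg_apply]; ring
  have hlm : ∀ (f : ℝ × ℝ → ℝ) (z v : ℝ × ℝ), IsLocalMax f z →
      IsLocalMax (fun t : ℝ => f (z + t • v)) 0 := by
    intro f z v hf
    have hc : Filter.Tendsto (fun t : ℝ => z + t • v) (nhds 0) (nhds z) := by
      have : Continuous (fun t : ℝ => z + t • v) := by fun_prop
      simpa using this.tendsto 0
    have := hc.eventually hf
    simpa [IsLocalMax, IsMaxFilter] using this
  have hcomp : ∀ z ∈ K, q z + w z ≤ p₁ + ε * exp (-α * A ^ 2) := by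
    intro y hy
    obtain ⟨z, hz, hmax⟩ := hK.exists_isMaxOn ⟨y, hy⟩ (hqcK.add cw.continuousOn)
    have hyz : q y + w y ≤ q z + w z := hmax hy
    refine hyz.trans ?_
    rcases eq_or_lt_of_le hz.2.2 with hd | hd
    · have h1 := hε z hz hd.symm
      have h2 : w z ≤ ε := by
        have : exp (-α * Φ z) ≤ 1 := by
          rw [Real.exp_le_one_iff]
          have : 0 ≤ Φ z := by simp only [Φ]; positivity
          nlinarith only [this, α0]
        simp only [w]; nlinarith only [this, ε0]
      have : 0 < ε * exp (-α * A ^ 2) := by positivity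
      linarith
    rcases eq_or_lt_of_le hz.1 with hd1 | hd1
    · have := hqle z (hKN hz)
      simp only [w, hd1]; linarith
    exfalso
    -- interior maximum
    have hnK : K ∈ nhds z := by
      have o1 : IsOpen {z | Φ z < A ^ 2} := isOpen_lt cΦ continuous_const
      have o2 : IsOpen {z | 0 < S z} := isOpen_lt continuous_const cS
      have o3 : IsOpen {z : ℝ × ℝ | ρ < dist z P} := isOpen_lt continuous_const (by fun_prop)
      filter_upwards [o1.mem_nhds hd1, o2.mem_nhds (hSpos z hz), o3.mem_nhds hd] with a h1 h2 h3
      exact ⟨le_of_lt h1, le_of_lt h2, le_of_lt h3⟩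
    have hloc : IsLocalMax (fun z => q z + w z) z := hmax.isLocalMax hnK
    have hzN := hKN hz
    -- first order information
    have E0 : 0 < ε * α * exp (-α * Φ z) := by positivity
    by_cases hzΩ : z ∈ Ω
    · have hqpe : q =ᶠ[nhds z] p := by
        filter_upwards [hN.mem_nhds hzN, hΩ.mem_nhds hzΩ] with a h1 h2 using hqp a ⟨h1, h2⟩
      have hloc' : IsLocalMax (fun z => p z + w z) z := by
        refine hloc.congr ?_
        filter_upwards [hqpe] with a ha
        simp only [ha]
      obtain ⟨l1, l2⟩ := aux_line p Ω hΩ hreg z z hzΩ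
      obtain ⟨m1, m2⟩ := aux_line p Ω hΩ hreg z (-z.2, z.1) hzΩ
      have r1 := aux_exp _ _ _ _ _ _ ε α l1 l2 (lineZ z) (lineZ' z) (hlm _ z z hloc')
      have r2 := aux_exp _ _ _ _ _ _ ε α m1 m2 (lineO z) (lineO' z) (hlm _ z _ hloc')
      simp only [zero_smul, add_zero] at r1 r2
      have eZ : 2 * (p₁ - 1 ^ 2 * r z - A) * -(2 * 1 * r z) + k * (2 * 1) * T z ^ 2 = Φz z := by
        simp only [Φz, X]; ring
      have eO : 2 * (p₁ - r z * (1 + 0 ^ 2) - A) * -(r z * (2 * 0)) + k * (2 * (T z + 0 * S z) * S z)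
          = Φo z := by
        simp only [Φo]; ring
      rw [eZ] at r1
      rw [eO] at r2
      obtain ⟨r1a, r1b⟩ := r1
      obtain ⟨r2a, r2b⟩ := r2
      have hαz := hα z hz
      have hpd := hpde z hzΩ
      have hpz := aux_pd p z z
      rw [← hpz] at hpd
      have hqz : q z = p z := hqpe.self_of_nhds
      have hfd : fderiv ℝ q z = fderiv ℝ p z := hqpe.fderiv_eq
      have hp0 : 0 < p z := hqz ▸ hqpos z hzN
      have hd0 : 0 ≤ p z - r z := hqz ▸ hdK z hz
      simp only [g, h] at hαz
      rw [hqz, hfd] at hαz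
      generalize ε * α * exp (-α * Φ z) = E at E0 r1a r1b r2a r2b hαz hpd
      generalize fderiv ℝ p z z = D at E0 r1a r1b r2a r2b hαz hpd
      generalize pdx (pdx p) z = a at E0 r1a r1b r2a r2b hαz hpd
      generalize pdy (pdx p) z = b at E0 r1a r1b r2a r2b hαz hpd
      generalize pdy (pdy p) z = c at E0 r1a r1b r2a r2b hαz hpd
      have i1 := mul_le_mul_of_nonneg_left r1b hd0
      have i2 := mul_le_mul_of_nonneg_left r2b hp0.le
      have i3 : (p z - r z) * (z.1 ^ 2 * a + 2 * z.1 * z.2 * b + z.2 ^ 2 * c)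
          + p z * ((-z.2) ^ 2 * a + 2 * (-z.2) * z.1 * b + z.1 ^ 2 * c)
          = r z * (2 * D - D ^ 2 / p z) := by
        have : r z = z.1 ^ 2 + z.2 ^ 2 := rfl
        rw [this]
        linear_combination (z.1 ^ 2 + z.2 ^ 2) * hpd
      have i4 := mul_pos E0 hαz
      have i5 : r z * (2 * D - D ^ 2 / p z) = E * (r z * (2 - D / p z) * Φz z) := by
        have : D ^ 2 / p z = D * (D / p z) := by ring
        rw [this]
        have : r z * (2 * D - D * (D / p z)) = r z * (2 - D / p z) * D := by ring
        rw [this]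
        conv_lhs => rw [mul_comm, r1a]
        rw [← r1a]; rw [r1a]; ring
      linarith only [i1, i2, i3, i4, i5]
    · have hg := hqgrad z hzN hzΩ
      have first : ∀ v : ℝ × ℝ, HasDerivAt (fun t : ℝ => q (z + t • v)) 0 0 := by
        intro v
        have hl : HasDerivAt (fun t : ℝ => z + t • v) v 0 := by
          simpa using ((hasDerivAt_id (0:ℝ)).smul_const v).const_add z
        have h1 : HasFDerivAt q (fderiv ℝ q z) (z + (0:ℝ) • v) := by
          simpa using (hqd z hzN).hasFDerivAt
        have := h1.comp_hasDerivAt (0:ℝ) hl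
        rw [hg] at this
        exact this.congr_deriv (by simp)
      have y1 := (hlm _ z z hloc).hasDerivAt_eq_zero
        ((first z).add ((((lineZ z 0).const_mul (-α)).exp).const_mul ε))
      have y2 := (hlm _ z (-z.2, z.1) hloc).hasDerivAt_eq_zero
        ((first _).add ((((lineO z 0).const_mul (-α)).exp).const_mul ε))
      simp only [zero_smul, add_zero] at y1 y2
      refine hcrit z hz ?_ ?_
      · have : (ε * α * exp (-α * Φ z)) * Φz z = 0 := by
          rw [← neg_eq_zero, ← y1]; simp only [Φz, X]; ring
        exact (mul_eq_zero.1 this).resolve_left E0.ne'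
      · have : (ε * α * exp (-α * Φ z)) * Φo z = 0 := by
          rw [← neg_eq_zero, ← y2]; simp only [Φo]; ring
        exact (mul_eq_zero.1 this).resolve_left E0.ne'
  -- the tip
  obtain ⟨s, hs⟩ : ∃ s, s = √(p₁ / R) := ⟨_, rfl⟩
  have hs0 : 0 < s := by rw [hs]; positivity
  have hs2 : s ^ 2 * R = p₁ := by
    rw [hs, Real.sq_sqrt (by positivity)]; field_simp
  let Q : ℝ × ℝ := s • P
  have hrQ : r Q = p₁ := by
    simp only [r, Q, Prod.smul_fst, Prod.smul_snd, smul_eq_mul]; rw [← hs2, hRdef]; ring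
  have hTQ : T Q = 0 := by
    simp only [T, Q, Prod.smul_fst, Prod.smul_snd, smul_eq_mul]; ring
  have hSQ : S Q = s * R := by
    simp only [S, Q, Prod.smul_fst, Prod.smul_snd, smul_eq_mul]; rw [hRdef]; ring
  have hΦQ : Φ Q = A ^ 2 := by simp only [Φ, X, hrQ, hTQ]; ring
  have hQΩ : Q ∉ Ω := by
    intro hQ
    have := hbnd Q hQ
    have h1 : Q.1 ^ 2 + Q.2 ^ 2 = p₁ := hrQ
    linarith [this.2.1, this.2.2]
  have hdQ : ρ < dist Q P := by
    by_contra hc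
    exact hQΩ (hρ (Metric.mem_closedBall.2 (not_lt.1 hc)))
  have hSQ0 : 0 < S Q := by rw [hSQ]; positivity
  have hQK : Q ∈ K := ⟨hΦQ.le, hSQ0.le, hdQ.le⟩
  have hqQ : q Q = p₁ := hqo Q ⟨hKN hQK, hQΩ⟩
  have hdq : HasDerivAt (fun t : ℝ => q (Q + t • Q)) 0 0 := by
    have hl : HasDerivAt (fun t : ℝ => Q + t • Q) Q 0 := by
      simpa using ((hasDerivAt_id (0:ℝ)).smul_const Q).const_add Q
    have h1 : HasFDerivAt q (fderiv ℝ q Q) (Q + (0:ℝ) • Q) := by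
      simpa using (hqd Q (hKN hQK)).hasFDerivAt
    have := h1.comp_hasDerivAt (0:ℝ) hl
    rw [hqgrad Q (hKN hQK) hQΩ] at this
    exact this.congr_deriv (by simp)
  have hdf := hdq.add ((((lineZ Q 0).const_mul (-α)).exp).const_mul ε)
  have hev : ∀ᶠ t : ℝ in nhdsWithin 0 (Iio 0), Q + t • Q ∈ K := by
    have cl : Continuous (fun t : ℝ => Q + t • Q) := by fun_prop
    have e1 : ∀ᶠ t : ℝ in nhds 0, 0 < S (Q + t • Q) :=
      continuousAt_const.eventually_lt (cS.comp cl).continuousAt (by simpa using hSQ0)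
    have e2 : ∀ᶠ t : ℝ in nhds 0, ρ < dist (Q + t • Q) P :=
      continuousAt_const.eventually_lt (cl.dist continuous_const).continuousAt (by simpa using hdQ)
    have e3 : ∀ᶠ t : ℝ in nhds 0, X (Q + t • Q) < A :=
      (cX.comp cl).continuousAt.eventually_lt continuousAt_const
        (by simp only [Function.comp, zero_smul, add_zero, X, hrQ]; linarith)
    have e4 : ∀ᶠ t : ℝ in nhds 0, -1 < t := lt_mem_nhds (by norm_num)
    filter_upwards [e1.filter_mono nhdsWithin_le_nhds, e2.filter_mono nhdsWithin_le_nhds,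
      e3.filter_mono nhdsWithin_le_nhds, e4.filter_mono nhdsWithin_le_nhds,
      self_mem_nhdsWithin] with t h1 h2 h3 h4 h5
    refine ⟨?_, h1.le, h2.le⟩
    have hT : T (Q + t • Q) = 0 := by
      have : T (Q + t • Q) = (1 + t) * T Q := by
        simp only [T, Prod.fst_add, Prod.snd_add, Prod.smul_fst, Prod.smul_snd, smul_eq_mul]; ring
      rw [this, hTQ, mul_zero]
    have hX : X (Q + t • Q) = p₁ * (-t * (2 + t)) := by
      have : X (Q + t • Q) = p₁ - (1 + t) ^ 2 * r Q := by
        simp only [X, r, Prod.fst_add, Prod.snd_add, Prod.smul_fst, Prod.smul_snd, smul_eq_mul]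
        ring
      rw [this, hrQ]; ring
    have h5' : t < 0 := h5
    have hX0 : 0 < X (Q + t • Q) := by
      rw [hX]; exact mul_pos hp1 (mul_pos (by linarith) (by linarith))
    simp only [Φ, hT]
    nlinarith only [hX0, h3]
  -- derivative at the tip is negative, but values are at most the value at the tip
  have hslope := (hasDerivAt_iff_tendsto_slope.1 hdf).mono_left
    (nhdsWithin_mono 0 (fun t (ht : t < 0) => ht.ne) : nhdsWithin (0:ℝ) (Iio 0) ≤ _)
  have hnn := ge_of_tendsto hslope (b := 0) (by
    filter_upwards [hev, self_mem_nhdsWithin] with t h1 h2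
    have h2' : t < 0 := h2
    have hc := hcomp _ h1
    rw [slope_def_field]
    apply div_nonneg_of_nonpos
    · simp only [Pi.add_apply, zero_smul, add_zero, hqQ, hΦQ]
      simp only [w] at hc
      linarith
    · linarith)
  simp only [zero_smul, add_zero, hΦQ, hrQ, hTQ] at hnn
  have hE : 0 < ε * α * exp (-α * A ^ 2) * (4 * p₁ * A) := by positivity
  nlinarith only [hE, hnn]
end

section
/- Let r₁ = √p₁ > 0 and introduce coordinates (x, y) = (r₁ − r, θ − θ₁) near the point P₁ = (0,0) where the shock meets the sonic circle. Let ε₀ > 0, ω > 0, μ₀ > 0, let f ∈ C^{1,1}([0, ε₀]) with f(0) = 0 and f′(x) ≥ ω for x ∈ (0, ε₀), and let Ω_{ε₀} = {(x,y) : 0 < x < ε₀, f(x) < y < π/2 − θ₁}. Suppose φ : Ω̄_{ε₀} → ℝ satisfies: (i) φ is Lipschitz continuous on Ω̄_{ε₀} with φ = 0 on {x = 0}; (ii) 0 ≤ φ(x,y) ≤ (2r₁ − μ₀)x on Ω_{ε₀}; (iii) there exist λ > 0 and functions β̂₁, β̂₂ on the shock graph {(x, f(x)) : 0 < x < ε₀}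 with β̂₁ ≥ λ and |β̂₂| ≤ 1/λ such that φ ∈ C¹ up to the shock and β̂₁ φ_x + β̂₂ φ_y = 0 on the shock; and (iv) along some sequence (xₘ, yₘ) → (0,0) in Ω_{ε₀} one has φ_x(xₘ, yₘ) → r₁ and φ_y(xₘ,yₘ) → 0, while φ_y(x, f(x)) → 0 as x → 0. Then the limit of φ_x(x, y) as (x, y) → (0, 0) within Ω_{ε₀} does not exist. -/
open Real Set Filter Topology

/-- Non-existence of the limit of `φ_x` at the corner point `P₁ = (0,0)`
where the shock meets the sonic circle (in the coordinates
`(x, y) = (r₁ − r, θ − θ₁)` flattening the sonic boundary). -/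
theorem stmt14
    (p₁ r₁ θ₁ : ℝ) (hr₁ : r₁ = Real.sqrt p₁) (hr₁pos : 0 < r₁)
    (ε₀ ω μ₀ : ℝ) (hε₀ : 0 < ε₀) (hω : 0 < ω) (hμ₀ : 0 < μ₀)
    (f : ℝ → ℝ) (K : NNReal)
    (hf1 : DifferentiableOn ℝ f (Set.Icc 0 ε₀))
    (hf2 : LipschitzOnWith K (deriv f) (Set.Icc 0 ε₀))
    (hf0 : f 0 = 0)
    (hf' : ∀ x ∈ Set.Ioo 0 ε₀, ω ≤ deriv f x)
    (Ω : Set (ℝ × ℝ))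
    (hΩ : Ω = {z : ℝ × ℝ | 0 < z.1 ∧ z.1 < ε₀ ∧ f z.1 < z.2 ∧ z.2 < π / 2 - θ₁})
    (φ : ℝ × ℝ → ℝ) (Kφ : NNReal)
    -- (i) φ is Lipschitz on the closure, vanishing on {x = 0}
    (hφlip : LipschitzOnWith Kφ φ (closure Ω))
    (hφ0 : ∀ z ∈ closure Ω, z.1 = 0 → φ z = 0)
    -- (ii) bounds
    (hφbound : ∀ z ∈ Ω, 0 ≤ φ z ∧ φ z ≤ (2 * r₁ - μ₀) * z.1)
    -- (iii) φ ∈ C¹ up to the shock, with the oblique derivative condition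
    (hφdiff : ∀ z ∈ Ω, DifferentiableAt ℝ φ z)
    (hshockdiff : ∀ x ∈ Set.Ioo 0 ε₀, DifferentiableAt ℝ φ (x, f x))
    (hobl : ∃ (lam : ℝ) (β₁ β₂ : ℝ → ℝ), 0 < lam ∧
      ∀ x ∈ Set.Ioo 0 ε₀, lam ≤ β₁ x ∧ |β₂ x| ≤ 1 / lam ∧
        β₁ x * pdx φ (x, f x) + β₂ x * pdy φ (x, f x) = 0)
    -- (iv) behaviour of Dφ near the corner
    (hseq : ∃ z : ℕ → ℝ × ℝ, (∀ m, z m ∈ Ω) ∧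
      Tendsto z atTop (nhds ((0 : ℝ), (0 : ℝ))) ∧
      Tendsto (fun m => pdx φ (z m)) atTop (nhds r₁) ∧
      Tendsto (fun m => pdy φ (z m)) atTop (nhds 0))
    (hshocky : Tendsto (fun x => pdy φ (x, f x)) (nhdsWithin 0 (Set.Ioi 0)) (nhds 0)) :
    ¬ ∃ L : ℝ, Tendsto (fun z => pdx φ z) (nhdsWithin ((0 : ℝ), (0 : ℝ)) Ω) (nhds L) := by
  rintro ⟨L, hL⟩
  obtain ⟨z, hzΩ, hz0, hzx, -⟩ := hseq
  obtain ⟨lam, β₁, β₂, hlam, hβ⟩ := hobl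
  have hzW : Tendsto z atTop (nhdsWithin ((0 : ℝ), (0 : ℝ)) Ω) :=
    tendsto_nhdsWithin_iff.2 ⟨hz0, Eventually.of_forall hzΩ⟩
  have hLr : L = r₁ := tendsto_nhds_unique (hL.comp hzW) hzx
  subst hLr
  have h00 : ((0 : ℝ), (0 : ℝ)) ∈ closure Ω :=
    mem_closure_of_tendsto hz0 (Eventually.of_forall hzΩ)
  have hfc : ContinuousOn f (Icc 0 ε₀) := hf1.continuousOn
  have hmono : StrictMonoOn f (Icc 0 ε₀) := by
    apply strictMonoOn_of_deriv_pos (convex_Icc 0 ε₀) hfc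
    intro x hx
    rw [interior_Icc] at hx
    exact lt_of_lt_of_le hω (hf' x hx)
  have hfpos : ∀ x, 0 < x → x < ε₀ → 0 < f x := by
    intro x h0 h1
    have := hmono (left_mem_Icc.2 hε₀.le) ⟨h0.le, h1.le⟩ h0
    rwa [hf0] at this
  have hfda : ∀ x ∈ Ioo 0 ε₀, HasDerivAt f (deriv f x) x := by
    intro x hx
    exact ((hf1 x (Ioo_subset_Icc_self hx)).differentiableAt
      (Icc_mem_nhds hx.1 hx.2)).hasDerivAt
  have hY : 0 < π / 2 - θ₁ := by
    have h := hzΩ 0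
    rw [hΩ] at h
    obtain ⟨h1, h2, h3, h4⟩ := h
    linarith [hfpos _ h1 h2]
  -- horizontal segments
  have hseg : ∀ x, 0 < x → x < ε₀ → f x < π / 2 - θ₁ → ∀ t ∈ Ioo 0 x, (t, f x) ∈ Ω := by
    intro x h0 h1 h2 t ht
    rw [hΩ]
    exact ⟨ht.1, ht.2.trans h1,
      hmono ⟨ht.1.le, (ht.2.trans h1).le⟩ ⟨h0.le, h1.le⟩ ht.2, h2⟩
  have hsegc : ∀ x, 0 < x → x < ε₀ → f x < π / 2 - θ₁ →
      ∀ t ∈ Icc 0 x, (t, f x) ∈ closure Ω := by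
    intro x h0 h1 h2 t ht
    have hc : t ∈ closure (Ioo 0 x) := by rwa [closure_Ioo h0.ne]
    exact map_mem_closure (f := fun t : ℝ => (t, f x)) (by fun_prop) hc (hseg x h0 h1 h2)
  -- bound for f'
  obtain ⟨C, hC0, hC⟩ : ∃ C : ℝ, 0 ≤ C ∧ ∀ x ∈ Ioo 0 ε₀, |deriv f x| ≤ C := by
    obtain ⟨C, hC⟩ := isCompact_Icc.exists_bound_of_continuousOn hf2.continuousOn
    exact ⟨C, (norm_nonneg _).trans (hC 0 (left_mem_Icc.2 hε₀.le)),
      fun x hx => hC x (Ioo_subset_Icc_self hx)⟩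
  set M : ℝ := 1 / lam / lam + C with hM
  have hMpos : 0 < M := by positivity
  -- shock smallness
  have hA : ∀ᶠ x in nhdsWithin (0 : ℝ) (Ioi 0), |pdy φ (x, f x)| < L / 4 / M := by
    have h := hshocky.abs
    rw [abs_zero] at h
    exact h.eventually (gt_mem_nhds (by positivity))
  obtain ⟨a, ha0, ha⟩ := (mem_nhdsGT_iff_exists_Ioo_subset).1 hA
  have ha0 : (0:ℝ) < a := ha0
  have hB : ∀ᶠ w in nhdsWithin ((0 : ℝ), (0 : ℝ)) Ω, L / 2 < pdx φ w :=
    hL.eventually (lt_mem_nhds (by linarith))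
  obtain ⟨δ, hδ, hB⟩ := Metric.mem_nhdsWithin_iff.1 hB
  -- choose x0
  have hft : Tendsto f (nhdsWithin 0 (Ioi 0)) (nhds 0) := by
    have h := (hfc 0 (left_mem_Icc.2 hε₀.le)).mono_left
      (nhdsWithin_le_of_mem (Icc_mem_nhdsGT hε₀))
    rwa [hf0] at h
  have hid : Tendsto (fun x : ℝ => x) (nhdsWithin 0 (Ioi 0)) (nhds 0) :=
    tendsto_id.mono_left nhdsWithin_le_nhds
  obtain ⟨x, hfY, hfδ, hxa, hxδ, hxε, hx0⟩ :=
    ((hft.eventually (gt_mem_nhds hY)).and ((hft.eventually (gt_mem_nhds hδ)).and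
      ((hid.eventually (gt_mem_nhds ha0)).and ((hid.eventually (gt_mem_nhds hδ)).and
      ((hid.eventually (gt_mem_nhds hε₀)).and self_mem_nhdsWithin))))).exists
  have hx0 : 0 < x := hx0
  have hφc : ContinuousOn φ (closure Ω) := hφlip.continuousOn
  -- along the horizontal segment
  have h1 : ∃ c ∈ Ioo 0 x, pdx φ (c, f x) = (φ (x, f x) - φ (0, f x)) / (x - 0) := by
    apply exists_hasDerivAt_eq_slope (fun t => φ (t, f x)) (fun t => pdx φ (t, f x)) hx0
    · exact hφc.comp (by fun_prop) (hsegc x hx0 hxε hfY)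
    · intro t ht
      have h := (hφdiff _ (hseg x hx0 hxε hfY t ht)).hasFDerivAt
      exact h.comp_hasDerivAt (f := fun t : ℝ => (t, f x)) t
        ((hasDerivAt_id t).prodMk (hasDerivAt_const t (f x)))
  have h2 : ∃ c ∈ Ioo 0 x, pdx φ (c, f c) + deriv f c * pdy φ (c, f c)
      = (φ (x, f x) - φ (0, f 0)) / (x - 0) := by
    apply exists_hasDerivAt_eq_slope (fun t => φ (t, f t))
      (fun c => pdx φ (c, f c) + deriv f c * pdy φ (c, f c)) hx0
    · refine hφc.comp (continuousOn_id.prodMk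
        (hfc.mono (Icc_subset_Icc_right hxε.le))) ?_
      intro t ht
      rcases ht.1.eq_or_lt with h | h
      · simpa [← h, hf0] using h00
      · have hle : f t ≤ f x := hmono.monotoneOn ⟨ht.1, ht.2.trans hxε.le⟩
          ⟨hx0.le, hxε.le⟩ ht.2
        exact hsegc t h (ht.2.trans_lt hxε) (hle.trans_lt hfY) t ⟨h.le, le_rfl⟩
    · intro t ht
      have htε : t ∈ Ioo 0 ε₀ := ⟨ht.1, ht.2.trans hxε⟩
      have h := (hshockdiff t htε).hasFDerivAt
      have h' := h.comp_hasDerivAt (f := fun t : ℝ => (t, f t)) t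
        ((hasDerivAt_id t).prodMk (hfda t htε))
      have e : ((1 : ℝ), deriv f t) = (1, 0) + deriv f t • ((0 : ℝ), (1 : ℝ)) := by simp
      rw [e, map_add, map_smul] at h'
      exact h'
  obtain ⟨c, hc, hce⟩ := h1
  obtain ⟨d, hd, hde⟩ := h2
  rw [hφ0 _ (hsegc x hx0 hxε hfY 0 ⟨le_rfl, hx0.le⟩) rfl] at hce
  rw [hf0, hφ0 _ h00 rfl, ← hce] at hde
  have hbig : L / 2 < pdx φ (c, f x) := by
    apply hB
    refine ⟨?_, hseg x hx0 hxε hfY c hc⟩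
    rw [Metric.mem_ball, Prod.dist_eq]
    simp only [Real.dist_eq, sub_zero]
    rw [abs_of_pos hc.1, abs_of_pos (hfpos x hx0 hxε)]
    exact max_lt (hc.2.trans hxδ) hfδ
  have hdε : d ∈ Ioo 0 ε₀ := ⟨hd.1, hd.2.trans hxε⟩
  have hsm : |pdy φ (d, f d)| < L / 4 / M := ha ⟨hd.1, hd.2.trans hxa⟩
  obtain ⟨hb1, hb2, hb3⟩ := hβ d hdε
  have hpx : |pdx φ (d, f d)| ≤ 1 / lam / lam * |pdy φ (d, f d)| := by
    have e : β₁ d * pdx φ (d, f d) = -(β₂ d * pdy φ (d, f d)) := by linarith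
    have e2 : |β₁ d| * |pdx φ (d, f d)| = |β₂ d| * |pdy φ (d, f d)| := by
      rw [← abs_mul, e, abs_neg, abs_mul]
    rw [div_mul_eq_mul_div, le_div_iff₀ hlam]
    calc |pdx φ (d, f d)| * lam ≤ |pdx φ (d, f d)| * |β₁ d| := by
          gcongr; exact hb1.trans (le_abs_self _)
      _ = |β₂ d| * |pdy φ (d, f d)| := by rw [mul_comm, e2]
      _ ≤ 1 / lam * |pdy φ (d, f d)| := by gcongr
  have hfin : |pdx φ (d, f d) + deriv f d * pdy φ (d, f d)| ≤ M * |pdy φ (d, f d)| := by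
    calc _ ≤ |pdx φ (d, f d)| + |deriv f d * pdy φ (d, f d)| := abs_add_le _ _
      _ ≤ 1 / lam / lam * |pdy φ (d, f d)| + C * |pdy φ (d, f d)| := by
          rw [abs_mul]
          gcongr
          exact hC d hdε
      _ = _ := by rw [hM]; ring
  have hfin2 : M * |pdy φ (d, f d)| < L / 4 := by
    rw [lt_div_iff₀ hMpos] at hsm
    linarith
  have := le_abs_self (pdx φ (d, f d) + deriv f d * pdy φ (d, f d))
  linarith
end
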